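/- For all positive integers n and all k ≥ 0, the number of EW-tableaux of size n having exactly k rows all of whose cells contain 0 equals the number of n-permutations with exactly k fixed points different from 1 (indices i ≥ 2 with a_i = i), and also equals the number of n-permutations with exactly k decreasing adjacencies. -/

import Mathlib

/-- A Ferrers diagram (shape): `r` rows; row `i` (for `i < r`) has `len i` cells,
left-aligned, with row lengths weakly decreasing from top to bottom and positive.
`len` is normalized to vanish for `i ≥ r`. -/
structure FerrersShape where
  r : ℕ
  len : ℕ → ℕ
  r_pos : 0 < r
  anti : ∀ i j, i ≤ j → j < r → len j ≤ len i
  len_pos : ∀ i, i < r → 0 < len i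
  len_zero : ∀ i, r ≤ i → len i = 0

/-- An EW-tableau of shape `F` (`one` normalized to `false` outside the diagram). -/
structure EWTableau (F : FerrersShape) where
  one : ℕ → ℕ → Bool
  support : ∀ i j, one i j = true → i < F.r ∧ j < F.len i
  top_row : ∀ j, j < F.len 0 → one 0 j = true
  has_zero : ∀ i, 0 < i → i < F.r → ∃ j, j < F.len i ∧ one i j = false
  no_rect : ∀ i i' j j', i < i' → i' < F.r → j < j' → j' < F.len i' →
    ¬(one i j = one i' j' ∧ one i j' = one i' j ∧ one i j ≠ one i j')

/-- An `n`-permutation, encoded as a map `a : ℕ → ℕ` permuting `{1,…,n}`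
(normalized to `0` off `{1,…,n}`); `a i` is the letter in place `i`. -/
def IsPermOn (n : ℕ) (a : ℕ → ℕ) : Prop :=
  Set.BijOn a (Set.Icc 1 n) (Set.Icc 1 n) ∧ ∀ i, i ∉ Set.Icc 1 n → a i = 0


def EwOk (L : Finset ℕ) (E : Finset (ℕ × ℕ)) : Prop :=
  (∀ r c, (r, c) ∈ E → r ∈ L ∧ c ∈ L ∧ r < c) ∧
  (∀ r c r' c', (r, c) ∈ E → (r', c') ∈ E → r ≠ c') ∧
  (∀ r c r' c', (r, c) ∈ E → (r', c') ∈ E → r < c' → r' < c → (r, c') ∈ E ∨ (r', c) ∈ E)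

open Classical in
noncomputable def ewC (L : Finset ℕ) : Finset (Finset (ℕ × ℕ)) :=
  ((L ×ˢ L).powerset).filter (EwOk L)

theorem mem_ewC {L : Finset ℕ} {E : Finset (ℕ × ℕ)} : E ∈ ewC L ↔ EwOk L E := by
  classical
  unfold ewC
  rw [Finset.mem_filter]
  refine ⟨fun h => h.2, fun h => ⟨?_, h⟩⟩
  rw [Finset.mem_powerset]
  rintro ⟨r, c⟩ hp
  have := h.1 r c hp
  simp [this.1, this.2.1]

def ewZ (I : Finset ℕ) (A B : Finset (ℕ × ℕ)) : Finset ℕ :=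
  B.image Prod.fst ∪ (I \ (A.image Prod.fst ∪ A.image Prod.snd))

theorem mem_ewZ {I : Finset ℕ} {A B : Finset (ℕ × ℕ)} {z : ℕ} :
    z ∈ ewZ I A B ↔ (∃ c, (z, c) ∈ B) ∨ (z ∈ I ∧ (∀ c, (z, c) ∉ A) ∧ ∀ r, (r, z) ∉ A) := by
  simp [ewZ]

def ewGlue (m : ℕ) (I : Finset ℕ) (A B : Finset (ℕ × ℕ)) : Finset (ℕ × ℕ) :=
  A ∪ B ∪ ((ewZ I A B) ×ˢ (insert m (A.image Prod.snd))).filter (fun p => p.1 < p.2)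

theorem mem_ewGlue {m : ℕ} {I : Finset ℕ} {A B : Finset (ℕ × ℕ)} {z c : ℕ} :
    (z, c) ∈ ewGlue m I A B ↔ (z, c) ∈ A ∨ (z, c) ∈ B ∨
      (z ∈ ewZ I A B ∧ (c = m ∨ ∃ r, (r, c) ∈ A) ∧ z < c) := by
  simp [ewGlue]; tauto

open Classical in
noncomputable def ewA (m : ℕ) (E : Finset (ℕ × ℕ)) : Finset (ℕ × ℕ) :=
  E.filter (fun p => (p.1, m) ∉ E)

open Classical in
noncomputable def ewB (m : ℕ) (E : Finset (ℕ × ℕ)) : Finset (ℕ × ℕ) :=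
  E.filter (fun p => (p.1, m) ∈ E ∧ p.2 ≠ m ∧ ∀ r, (r, p.2) ∉ ewA m E)

open Classical in
noncomputable def ewI (m : ℕ) (E : Finset (ℕ × ℕ)) : Finset ℕ :=
  (ewA m E).image Prod.fst ∪ (ewA m E).image Prod.snd ∪
    (E.image Prod.fst).filter (fun z => (z, m) ∈ E ∧ ∀ c, (z, c) ∉ ewB m E)

theorem mem_ewA {m : ℕ} {E : Finset (ℕ × ℕ)} {r c : ℕ} :
    (r, c) ∈ ewA m E ↔ (r, c) ∈ E ∧ (r, m) ∉ E := by simp [ewA]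

theorem mem_ewB {m : ℕ} {E : Finset (ℕ × ℕ)} {r c : ℕ} :
    (r, c) ∈ ewB m E ↔ (r, c) ∈ E ∧ (r, m) ∈ E ∧ c ≠ m ∧ ∀ r, (r, c) ∉ ewA m E := by simp [ewB]

theorem mem_ewI {m : ℕ} {E : Finset (ℕ × ℕ)} {x : ℕ} :
    x ∈ ewI m E ↔ (∃ c, (x, c) ∈ ewA m E) ∨ (∃ r, (r, x) ∈ ewA m E) ∨
      ((x, m) ∈ E ∧ ∀ c, (x, c) ∉ ewB m E) := by
  simp only [ewI, Finset.mem_union, Finset.mem_image, Finset.mem_filter, Prod.exists, exists_and_right, exists_eq_right]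
  constructor
  · rintro ((h | h) | h) <;> tauto
  · rintro (h | h | h)
    · tauto
    · tauto
    · exact Or.inr ⟨⟨m, h.1⟩, h⟩

theorem ewGlue_ok {m : ℕ} {L I : Finset ℕ} {A B : Finset (ℕ × ℕ)} (hm : ∀ x ∈ L, x < m)
    (hI : I ⊆ L) (hA : EwOk I A) (hB : EwOk (L \ I) B) : EwOk (insert m L) (ewGlue m I A B) := by
  obtain ⟨a1, a2, a3⟩ := hA
  obtain ⟨b1, b2, b3⟩ := hB
  refine ⟨?_, ?_, ?_⟩
  · intro r c h
    simp only [mem_ewGlue, mem_ewZ] at h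
    grind
  · intro r c r' c' h h'
    simp only [mem_ewGlue, mem_ewZ] at h h'
    clear a3 b3
    rintro rfl
    have hI' : ∀ x, x ∈ I → x ∈ L := fun x hx => hI hx
    have b1' : ∀ r c, (r, c) ∈ B → (r ∈ L ∧ r ∉ I) ∧ (c ∈ L ∧ c ∉ I) := by
      intro r c h
      have := b1 r c h
      exact ⟨Finset.mem_sdiff.1 this.1, Finset.mem_sdiff.1 this.2.1⟩
    have hr : r ∈ L := by
      rcases h with h | h | ⟨⟨_, h⟩ | h, _⟩
      · exact hI (a1 _ _ h).1
      · exact (b1' _ _ h).1.1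
      · exact (b1' _ _ h).1.1
      · exact hI h.1
    have hrm := hm r hr
    rcases h' with h' | h' | ⟨_, h' | ⟨_, h'⟩, _⟩
    · have := (a1 _ _ h').2.1
      rcases h with h | h | ⟨⟨_, h⟩ | h, _⟩
      · exact a2 _ _ _ _ h h' rfl
      · exact (b1' _ _ h).1.2 this
      · exact (b1' _ _ h).1.2 this
      · exact h.2.2 _ h'
    · have := (b1' _ _ h').2.2
      rcases h with h | h | ⟨⟨_, h⟩ | h, _⟩
      · exact this (a1 _ _ h).1
      · exact b2 _ _ _ _ h h' rfl
      · exact b2 _ _ _ _ h h' rfl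
      · exact this h.1
    · omega
    · have := (a1 _ _ h').2.1
      rcases h with h | h | ⟨⟨_, h⟩ | h, _⟩
      · exact a2 _ _ _ _ h h' rfl
      · exact (b1' _ _ h).1.2 this
      · exact (b1' _ _ h).1.2 this
      · exact h.2.2 _ h'
  · intro r c r' c' h h' h1 h2
    simp only [mem_ewGlue] at h h' ⊢
    have zz : ∀ z c, (z,c) ∈ B → z ∈ ewZ I A B := fun z c h => mem_ewZ.2 (Or.inl ⟨c, h⟩)
    grind

theorem ewA_ok {m : ℕ} {L : Finset ℕ} {E : Finset (ℕ × ℕ)} (hm : ∀ x ∈ L, x < m)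
    (hE : EwOk (insert m L) E) :
    ewI m E ⊆ L ∧ EwOk (ewI m E) (ewA m E) ∧ EwOk (L \ ewI m E) (ewB m E) := by
  obtain ⟨a1, a2, a3⟩ := hE
  refine ⟨?_, ⟨?_, ?_, ?_⟩, ⟨?_, ?_, ?_⟩⟩
  · intro x hx
    simp only [mem_ewI, mem_ewA, mem_ewB] at hx
    grind
  · intro r c h
    have h0 := mem_ewA.1 h
    exact ⟨mem_ewI.2 (Or.inl ⟨_, h⟩), mem_ewI.2 (Or.inr (Or.inl ⟨_, h⟩)), (a1 _ _ h0.1).2.2⟩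
  · intro r c r' c' h h'
    exact a2 _ _ _ _ (mem_ewA.1 h).1 (mem_ewA.1 h').1
  · intro r c r' c' h h' h1 h2
    simp only [mem_ewA] at *
    grind
  · intro r c h
    have h0 := mem_ewB.1 h
    simp only [Finset.mem_sdiff, mem_ewI]
    have := a1 _ _ h0.1
    have n1 : ∀ c, (r,c) ∉ ewA m E := by simp only [mem_ewA]; grind
    have n2 : ∀ r', (r',r) ∉ ewA m E := by simp only [mem_ewA]; grind
    have n3 : ∀ c', (c,c') ∉ ewA m E := by simp only [mem_ewA]; grind
    grind
  · intro r c r' c' h h'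
    exact a2 _ _ _ _ (mem_ewB.1 h).1 (mem_ewB.1 h').1
  · intro r c r' c' h h' h1 h2
    simp only [mem_ewB] at *
    grind

theorem ewA_glue {m : ℕ} {L I : Finset ℕ} {A B : Finset (ℕ × ℕ)} (hm : ∀ x ∈ L, x < m)
    (hI : I ⊆ L) (hA : EwOk I A) (hB : EwOk (L \ I) B) :
    ewI m (ewGlue m I A B) = I ∧ ewA m (ewGlue m I A B) = A ∧ ewB m (ewGlue m I A B) = B := by
  obtain ⟨a1, a2, a3⟩ := hA
  obtain ⟨b1, b2, b3⟩ := hB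
  have hz : ∀ z, (z, m) ∈ ewGlue m I A B ↔ z ∈ ewZ I A B := by
    intro z
    simp only [mem_ewGlue, mem_ewZ]
    grind
  have hAA : ewA m (ewGlue m I A B) = A := by
    ext ⟨r, c⟩
    rw [mem_ewA, hz, mem_ewGlue]
    simp only [mem_ewZ]
    grind
  have hBB : ewB m (ewGlue m I A B) = B := by
    ext ⟨r, c⟩
    rw [mem_ewB, hz, hAA, mem_ewGlue]
    simp only [mem_ewZ]
    grind
  refine ⟨?_, hAA, hBB⟩
  ext x
  rw [mem_ewI, hAA, hBB, hz, mem_ewZ]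
  grind

theorem ewGlue_A {m : ℕ} {L : Finset ℕ} {E : Finset (ℕ × ℕ)} (hm : ∀ x ∈ L, x < m)
    (hE : EwOk (insert m L) E) : ewGlue m (ewI m E) (ewA m E) (ewB m E) = E := by
  obtain ⟨a1, a2, a3⟩ := hE
  have hZ : ∀ z, z ∈ ewZ (ewI m E) (ewA m E) (ewB m E) ↔ (z, m) ∈ E := by
    intro z
    rw [mem_ewZ]
    have n1 : (z,m) ∈ E → ∀ c, (z,c) ∉ ewA m E := by simp only [mem_ewA]; grind
    have n2 : (z,m) ∈ E → ∀ r', (r',z) ∉ ewA m E := by simp only [mem_ewA]; grind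
    have n3 : ∀ c, (z, c) ∈ ewB m E → (z,m) ∈ E := fun c h => (mem_ewB.1 h).2.1
    rw [mem_ewI]
    grind
  ext ⟨r, c⟩
  rw [mem_ewGlue, hZ, mem_ewB]
  simp only [mem_ewA]
  grind

theorem card_ewC_insert {m : ℕ} {L : Finset ℕ} (hm : ∀ x ∈ L, x < m) :
    (ewC (insert m L)).card = ∑ I ∈ L.powerset, (ewC I).card * (ewC (L \ I)).card := by
  simp_rw [← Finset.card_product]
  rw [← Finset.card_sigma]
  symm
  refine Finset.card_nbij' (fun x => ewGlue m x.1 x.2.1 x.2.2)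
    (fun E => ⟨ewI m E, ewA m E, ewB m E⟩) ?_ ?_ ?_ ?_
  · rintro ⟨I, A, B⟩ h
    simp only [Finset.coe_sigma, Set.mem_sigma_iff, Finset.mem_coe, Finset.mem_powerset, Finset.mem_product, mem_ewC] at h ⊢
    exact ewGlue_ok hm h.1 h.2.1 h.2.2
  · intro E h
    simp only [Finset.coe_sigma, Set.mem_sigma_iff, Finset.mem_coe, Finset.mem_powerset, Finset.mem_product, mem_ewC] at h ⊢
    exact ewA_ok hm h
  · rintro ⟨I, A, B⟩ h
    simp only [Finset.coe_sigma, Set.mem_sigma_iff, Finset.mem_coe, Finset.mem_powerset, Finset.mem_product, mem_ewC] at h ⊢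
    obtain ⟨e1, e2, e3⟩ := ewA_glue hm h.1 h.2.1 h.2.2
    rw [e1, e2, e3]
  · intro E h
    simp only [Finset.mem_coe, mem_ewC] at h ⊢
    exact ewGlue_A hm h

theorem card_ewC (n : ℕ) : ∀ L : Finset ℕ, L.card = n → (ewC L).card = n.factorial := by
  induction n using Nat.strong_induction_on with
  | _ n ih =>
  intro L hL
  induction L using Finset.induction_on_max with
  | empty =>
    simp at hL
    subst hL
    simp only [Nat.factorial_zero]
    rw [Finset.card_eq_one]
    refine ⟨∅, ?_⟩
    ext E
    rw [mem_ewC]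
    simp only [Finset.mem_singleton]
    constructor
    · intro h
      ext ⟨r, c⟩
      have := h.1 r c
      simp at this ⊢
      exact this
    · rintro rfl
      simp [EwOk]
  | insert m L hm _ =>
    rw [card_ewC_insert hm]
    rw [Finset.card_insert_of_notMem (fun h => lt_irrefl _ (hm _ h))] at hL
    have : ∀ I ∈ L.powerset, (ewC I).card * (ewC (L \ I)).card
        = (I.card).factorial * (L.card - I.card).factorial := by
      intro I hI
      rw [Finset.mem_powerset] at hI
      have h1 := Finset.card_le_card hI
      rw [ih I.card (by omega) I rfl, ih (L.card - I.card) (by omega) (L \ I)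
        (Finset.card_sdiff_of_subset hI)]
    rw [Finset.sum_congr rfl this,
      Finset.sum_powerset_apply_card (fun k => k.factorial * (L.card - k).factorial)]
    have : ∀ k ∈ Finset.range (L.card + 1),
        L.card.choose k • (k.factorial * (L.card - k).factorial) = L.card.factorial := by
      intro k hk
      rw [smul_eq_mul, ← mul_assoc]
      exact Nat.choose_mul_factorial_mul_factorial (by simpa [Nat.lt_succ_iff] using hk)
    rw [Finset.sum_congr rfl this, Finset.sum_const, Finset.card_range, smul_eq_mul, ← hL,
      Nat.factorial_succ]


theorem isPermOn_iff (n : ℕ) (a : ℕ → ℕ) : IsPermOn n a ↔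
    (∀ i, 1 ≤ i → i ≤ n → 1 ≤ a i ∧ a i ≤ n) ∧
    (∀ i j, 1 ≤ i → i ≤ n → 1 ≤ j → j ≤ n → a i = a j → i = j) ∧
    a 0 = 0 ∧ (∀ i, n < i → a i = 0) := by
  constructor
  · rintro ⟨⟨h1, h2, h3⟩, h4⟩
    refine ⟨fun i hi hi' => h1 ⟨hi, hi'⟩, fun i j hi hi' hj hj' h => h2 ⟨hi, hi'⟩ ⟨hj, hj'⟩ h,
      h4 0 (by simp), fun i hi => h4 i (by simp; omega)⟩
  · rintro ⟨h1, h2, h3, h4⟩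
    refine ⟨⟨fun i hi => h1 i hi.1 hi.2, fun i hi j hj h => h2 i j hi.1 hi.2 hj.1 hj.2 h, ?_⟩, ?_⟩
    · have := Finset.surjOn_of_injOn_of_card_le (s := Finset.Icc 1 n) (t := Finset.Icc 1 n) a
        (fun i hi => by simp at hi ⊢; exact h1 i hi.1 hi.2)
        (fun i hi j hj h => by simp at hi hj; exact h2 i j hi.1 hi.2 hj.1 hj.2 h) le_rfl
      simpa using this
    · intro i hi
      simp at hi
      rcases Nat.eq_zero_or_pos i with rfl | h
      · exact h3
      · exact h4 i (hi h)

theorem card_perm_fix (n : ℕ) (S : Finset ℕ) (hS : S ⊆ Finset.Icc 1 n) :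
    Nat.card {a : ℕ → ℕ // IsPermOn n a ∧ ∀ i, 1 ≤ i → i ≤ n → i ∉ S → a i = i}
      = S.card.factorial := by
  classical
  have h1 : Nat.card {f : Equiv.Perm ℕ // ∀ x, ¬ x ∈ S → f x = x} = S.card.factorial := by
    rw [← Nat.card_congr (Equiv.Perm.subtypeEquivSubtypePerm (fun x => x ∈ S)),
      Nat.card_eq_fintype_card, Fintype.card_perm, Fintype.card_coe]
  rw [← h1]
  symm
  have hS' : ∀ x, x ∈ S → 1 ≤ x ∧ x ≤ n := fun x hx => by simpa using hS hx
  have hout : ∀ f : Equiv.Perm ℕ, (∀ x, ¬ x ∈ S → f x = x) → ∀ i, 1 ≤ i → i ≤ n → 1 ≤ f i ∧ f i ≤ n := by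
    intro f hf i hi hi'
    by_cases h : i ∈ S
    · apply hS'
      by_contra hc
      have := f.injective (hf _ hc)
      rw [this] at hc
      exact hc h
    · rw [hf i h]; exact ⟨hi, hi'⟩
  refine Nat.card_eq_of_bijective
    (fun f => ⟨fun i => if 1 ≤ i ∧ i ≤ n then f.1 i else 0, ?_, ?_⟩) ⟨?_, ?_⟩
  · rw [isPermOn_iff]
    refine ⟨?_, ?_, by simp, ?_⟩
    · intro i hi hi'
      simp only [hi, hi', and_self, if_true]
      exact hout f.1 f.2 i hi hi'
    · intro i j hi hi' hj hj' h
      simp only [hi, hi', hj, hj', and_self, if_true] at h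
      exact f.1.injective h
    · intro i hi
      rw [if_neg (by omega)]
  · intro i hi hi' hS
    simp only [hi, hi', and_self, if_true]
    exact f.2 i hS
  · rintro ⟨f, hf⟩ ⟨g, hg⟩ h
    simp only [Subtype.mk.injEq] at h ⊢
    ext i
    by_cases hi : 1 ≤ i ∧ i ≤ n
    · have := congrFun h i
      simpa [hi] using this
    · rw [hf i (fun h => hi (hS' _ h)), hg i (fun h => hi (hS' _ h))]
  · rintro ⟨a, ha, ha'⟩
    have ha0 := ha.1
    rw [isPermOn_iff] at ha
    obtain ⟨p1, p2, p3, p4⟩ := ha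
    have hb : Function.Bijective (fun i => if 1 ≤ i ∧ i ≤ n then a i else i) := by
      constructor
      · intro i j h
        simp only at h
        by_cases hi : 1 ≤ i ∧ i ≤ n <;> by_cases hj : 1 ≤ j ∧ j ≤ n
        · simp only [hi, hj, and_self, if_true] at h
          exact p2 i j hi.1 hi.2 hj.1 hj.2 h
        · rw [if_pos hi, if_neg hj] at h
          have := p1 i hi.1 hi.2
          omega
        · rw [if_neg hi, if_pos hj] at h
          have := p1 j hj.1 hj.2
          omega
        · rw [if_neg hi, if_neg hj] at h
          exact h
      · intro i
        by_cases hi : 1 ≤ i ∧ i ≤ n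
        · obtain ⟨j, hj, rfl⟩ := ha0.2.2 hi
          exact ⟨j, if_pos hj⟩
        · exact ⟨i, if_neg hi⟩
    refine ⟨⟨Equiv.ofBijective _ hb, ?_⟩, ?_⟩
    · intro x hx
      simp only [Equiv.ofBijective_apply]
      split_ifs with h
      · exact ha' x h.1 h.2 hx
      · rfl
    · simp only [Subtype.mk.injEq, Equiv.ofBijective_apply]
      ext i
      split_ifs with h
      · rfl
      · rcases Nat.eq_zero_or_pos i with rfl | h'
        · exact p3.symm
        · exact (p4 i (by omega)).symm

def glueAdj (p : ℕ) (a : ℕ → ℕ) : ℕ → ℕ := fun j =>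
  if j = p + 1 then a p else
    (if a p ≤ a (if j ≤ p then j else j - 1) then a (if j ≤ p then j else j - 1) + 1
      else a (if j ≤ p then j else j - 1))

def unglueAdj (p : ℕ) (a : ℕ → ℕ) : ℕ → ℕ := fun j =>
  if a (p + 1) < a (if j ≤ p then j else j + 1) then a (if j ≤ p then j else j + 1) - 1
      else a (if j ≤ p then j else j + 1)

theorem glueAdj_perm (n p : ℕ) (hp : 1 ≤ p) (hpn : p ≤ n) (a : ℕ → ℕ) (ha : IsPermOn n a) :
    IsPermOn (n + 1) (glueAdj p a) := by
  rw [isPermOn_iff] at *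
  obtain ⟨p1, p2, p3, p4⟩ := ha
  have hv := p1 p hp hpn
  refine ⟨?_, ?_, ?_, ?_⟩
  · intro i hi hi'
    have h1 := p1 i
    have h2 := p1 (i - 1)
    simp only [glueAdj]
    grind
  · intro i j hi hi' hj hj' h
    simp only [glueAdj] at h
    have := p2 (if i ≤ p then i else i - 1) (if j ≤ p then j else j - 1)
    grind
  · simp only [glueAdj]
    grind
  · intro i hi
    have := p4 (i - 1)
    simp only [glueAdj]
    grind

theorem unglueAdj_perm (n p : ℕ) (hp : 1 ≤ p) (hpn : p ≤ n) (a : ℕ → ℕ) (ha : IsPermOn (n + 1) a)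
    (h0 : a p = a (p + 1) + 1) :
    IsPermOn n (unglueAdj p a) := by
  rw [isPermOn_iff] at *
  obtain ⟨p1, p2, p3, p4⟩ := ha
  have hv := p1 p hp (by omega)
  have hv' := p1 (p + 1) (by omega) (by omega)
  refine ⟨?_, ?_, ?_, ?_⟩
  · intro i hi hi'
    have h1 := p1 i
    have h2 := p1 (i + 1)
    have h3 := p2 i (p + 1)
    have h4 := p2 (i + 1) (p + 1)
    simp only [unglueAdj]
    grind
  · intro i j hi hi' hj hj' h
    simp only [unglueAdj] at h
    have := p2 (if i ≤ p then i else i + 1) (if j ≤ p then j else j + 1)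
    have := p2 (if i ≤ p then i else i + 1) (p + 1)
    have := p2 (if j ≤ p then j else j + 1) (p + 1)
    grind
  · simp only [unglueAdj]
    grind
  · intro i hi
    have := p4 (i + 1)
    simp only [unglueAdj]
    grind

theorem unglue_glue (n p : ℕ) (hp : 1 ≤ p) (hpn : p ≤ n) (a : ℕ → ℕ) (ha : IsPermOn n a) :
    unglueAdj p (glueAdj p a) = a := by
  rw [isPermOn_iff] at *
  obtain ⟨p1, p2, p3, p4⟩ := ha
  ext j
  have e : (if (if j ≤ p then j else j + 1) ≤ p then (if j ≤ p then j else j + 1) else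
      (if j ≤ p then j else j + 1) - 1) = j := by grind
  have e2 : (if j ≤ p then j else j + 1) ≠ p + 1 := by grind
  simp only [unglueAdj, glueAdj, e, if_neg e2]
  grind

theorem glue_unglue (n p : ℕ) (hp : 1 ≤ p) (hpn : p ≤ n) (a : ℕ → ℕ) (ha : IsPermOn (n + 1) a)
    (h0 : a p = a (p + 1) + 1) : glueAdj p (unglueAdj p a) = a := by
  rw [isPermOn_iff] at *
  obtain ⟨p1, p2, p3, p4⟩ := ha
  have hv' := p1 (p + 1) (by omega) (by omega)
  have hu : unglueAdj p a p = a (p + 1) := by simp only [unglueAdj]; grind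
  ext j
  by_cases hj : j = p + 1
  · simp [glueAdj, hj, hu]
  have e : (if (if j ≤ p then j else j - 1) ≤ p then (if j ≤ p then j else j - 1) else
      (if j ≤ p then j else j - 1) + 1) = j := by grind
  have hne : a j ≠ a (p + 1) := by
    intro h
    by_cases h1 : 1 ≤ j ∧ j ≤ n + 1
    · exact hj (p2 j (p + 1) h1.1 h1.2 (by omega) (by omega) h)
    · rcases Nat.eq_zero_or_pos j with rfl | h'
      · omega
      · have := p4 j (by omega)
        omega
  have hw : unglueAdj p a (if j ≤ p then j else j - 1) = if a (p + 1) < a j then a j - 1 else a j := by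
    simp only [unglueAdj, e]
  simp only [glueAdj, if_neg hj, hu, hw]
  grind

theorem glueAdj_pos (n p : ℕ) (hp : 1 ≤ p) (hpn : p ≤ n) (a : ℕ → ℕ) (ha : IsPermOn n a) :
    glueAdj p a p = glueAdj p a (p + 1) + 1 := by
  simp [glueAdj]

theorem glueAdj_iff (n p i : ℕ) (hp : 1 ≤ p) (hpn : p ≤ n) (a : ℕ → ℕ) (ha : IsPermOn n a)
    (hi : 1 ≤ i) (hip : i < p) :
    glueAdj p a i = glueAdj p a (i + 1) + 1 ↔ a i = a (i + 1) + 1 := by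
  rw [isPermOn_iff] at *
  obtain ⟨p1, p2, p3, p4⟩ := ha
  have := p2 i p hi (by omega) hp hpn
  have h1 : i + 1 ≤ p := hip
  have h2 : i ≠ p + 1 := by omega
  have h3 : i ≤ p := by omega
  simp only [glueAdj, h1, h2, h3, if_true, if_false]
  grind

theorem card_adj (K : Finset ℕ) : ∀ n, 1 ≤ n → K ⊆ Finset.range (n - 1) →
    Nat.card {a : ℕ → ℕ // IsPermOn n a ∧ ∀ i ∈ K, a (i + 1) = a (i + 2) + 1}
      = (n - K.card).factorial := by
  induction K using Finset.induction_on_max with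
  | empty =>
    intro n _ _
    have := card_perm_fix n (Finset.Icc 1 n) (Finset.Subset.refl _)
    rw [Nat.card_Icc] at this
    simp only [Finset.card_empty, Nat.sub_zero]
    rw [show n + 1 - 1 = n by omega] at this
    rw [← this]
    refine Nat.card_congr (Equiv.subtypeEquivRight fun a => ?_)
    simp
    intro _ i hi hi' h
    omega
  | insert i K hi ih =>
    intro n hn hK
    have hiK : i ∈ Finset.range (n - 1) := hK (Finset.mem_insert_self _ _)
    rw [Finset.mem_range] at hiK
    obtain ⟨m, rfl⟩ : ∃ m, n = m + 1 := ⟨n - 1, by omega⟩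
    rw [Finset.card_insert_of_notMem (fun h => lt_irrefl _ (hi _ h))]
    rw [show m + 1 - (K.card + 1) = m - K.card by omega]
    rw [← ih m (by omega) (fun x hx => by have := hi x hx; rw [Finset.mem_range]; omega)]
    have hg : ∀ a, IsPermOn m a → ∀ x ∈ K,
        (glueAdj (i + 1) a (x + 1) = glueAdj (i + 1) a (x + 2) + 1 ↔ a (x + 1) = a (x + 2) + 1) :=
      fun a ha x hx => glueAdj_iff m (i + 1) (x + 1) (by omega) (by omega) a ha (by omega)
        (by have := hi x hx; omega)
    symm
    refine Nat.card_eq_of_bijective (fun a => ⟨glueAdj (i + 1) a.1, ?_, ?_⟩) ⟨?_, ?_⟩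
    · exact glueAdj_perm m (i + 1) (by omega) (by omega) a.1 a.2.1
    · intro x hx
      rw [Finset.mem_insert] at hx
      rcases hx with rfl | hx
      · exact glueAdj_pos m (x + 1) (by omega) (by omega) a.1 a.2.1
      · rw [hg a.1 a.2.1 x hx]
        exact a.2.2 x hx
    · rintro ⟨a, ha, _⟩ ⟨b, hb, _⟩ h
      simp only [Subtype.mk.injEq] at h ⊢
      rw [← unglue_glue m (i + 1) (by omega) (by omega) a ha, h,
        unglue_glue m (i + 1) (by omega) (by omega) b hb]
    · rintro ⟨a, ha, ha'⟩
      have h0 := ha' i (Finset.mem_insert_self _ _)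
      have hu := unglueAdj_perm m (i + 1) (by omega) (by omega) a ha h0
      have hgu := glue_unglue m (i + 1) (by omega) (by omega) a ha h0
      refine ⟨⟨unglueAdj (i + 1) a, hu, ?_⟩, ?_⟩
      · intro x hx
        rw [← hg _ hu x hx, hgu]
        exact ha' x (Finset.mem_insert_of_mem hx)
      · simp only [Subtype.mk.injEq]
        exact hgu

theorem incl_excl {α β : Type} [Finite α] [Finite β] (M : Finset ℕ) (s : α → Finset ℕ)
    (t : β → Finset ℕ) (hs : ∀ a, s a ⊆ M) (ht : ∀ b, t b ⊆ M)
    (h : ∀ K ⊆ M, Nat.card {a // K ⊆ s a} = Nat.card {b // K ⊆ t b}) (k : ℕ) :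
    Nat.card {a // (s a).card = k} = Nat.card {b // (t b).card = k} := by
  classical
  have := Fintype.ofFinite α
  have := Fintype.ofFinite β
  simp only [Nat.card_eq_fintype_card, Fintype.card_subtype] at h ⊢
  have key : ∀ d, ∀ K ⊆ M, (M \ K).card = d →
      (Finset.univ.filter fun a => s a = K).card = (Finset.univ.filter fun b => t b = K).card := by
    intro d
    induction d using Nat.strong_induction_on with
    | _ d ih =>
    intro K hK hd
    have gen : ∀ {γ : Type} [Fintype γ] (u : γ → Finset ℕ), (∀ a, u a ⊆ M) →
        (Finset.univ.filter fun a => K ⊆ u a).card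
        = (Finset.univ.filter fun a => u a = K).card +
          ∑ J ∈ M.powerset.filter (fun J => K ⊂ J), (Finset.univ.filter fun a => u a = J).card := by
      intro γ _ u hu
      rw [Finset.card_eq_sum_card_fiberwise (f := u) (t := insert K (M.powerset.filter (fun J => K ⊂ J)))]
      · rw [Finset.sum_insert (by simp)]
        congr 1
        · congr 1
          ext a
          simp only [Finset.mem_filter, Finset.mem_univ, true_and]
          exact ⟨fun h => h.2, fun h => ⟨h ▸ Finset.Subset.refl _, h⟩⟩
        · refine Finset.sum_congr rfl fun J hJ => ?_
          congr 1
          ext a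
          simp only [Finset.mem_filter, Finset.mem_univ, true_and] at hJ ⊢
          exact ⟨fun h => h.2, fun h => ⟨h ▸ hJ.2.subset, h⟩⟩
      · intro a ha
        simp only [Finset.coe_filter, Finset.mem_univ, true_and, Set.mem_setOf_eq] at ha
        simp only [Finset.coe_insert, Set.mem_insert_iff, Finset.mem_coe, Finset.mem_filter, Finset.mem_powerset]
        rcases eq_or_ne (u a) K with h | h
        · exact Or.inl h
        · exact Or.inr ⟨hu a, ha.ssubset_of_ne h.symm⟩
    have h1 := h K hK
    rw [gen s hs, gen t ht] at h1
    have h2 : ∑ J ∈ M.powerset.filter (fun J => K ⊂ J), (Finset.univ.filter fun a => s a = J).card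
        = ∑ J ∈ M.powerset.filter (fun J => K ⊂ J), (Finset.univ.filter fun a => t a = J).card := by
      refine Finset.sum_congr rfl fun J hJ => ?_
      simp only [Finset.mem_filter, Finset.mem_powerset] at hJ
      refine ih (M \ J).card ?_ J hJ.1 rfl
      rw [← hd]
      have q1 := Finset.card_lt_card hJ.2
      have q2 := Finset.card_le_card hJ.1
      rw [Finset.card_sdiff_of_subset hJ.1, Finset.card_sdiff_of_subset hK]
      omega
    omega
  have gen : ∀ {γ : Type} [Fintype γ] (u : γ → Finset ℕ), (∀ a, u a ⊆ M) →
      (Finset.univ.filter fun a => (u a).card = k).card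
      = ∑ J ∈ M.powersetCard k, (Finset.univ.filter fun a => u a = J).card := by
    intro γ _ u hu
    rw [Finset.card_eq_sum_card_fiberwise (f := u) (t := M.powersetCard k)]
    · refine Finset.sum_congr rfl fun J hJ => ?_
      congr 1
      ext a
      simp only [Finset.mem_filter, Finset.mem_univ, true_and, Finset.mem_powersetCard] at hJ ⊢
      exact ⟨fun h => h.2, fun h => ⟨h ▸ hJ.2, h⟩⟩
    · intro a ha
      simp only [Finset.coe_filter, Finset.mem_univ, true_and, Set.mem_setOf_eq] at ha
      simp only [Finset.mem_coe, Finset.mem_powersetCard]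
      exact ⟨hu a, ha⟩
  rw [gen s hs, gen t ht]
  refine Finset.sum_congr rfl fun J hJ => key _ J (Finset.mem_powersetCard.1 hJ).1 rfl

def ewZr (n : ℕ) (E : Finset (ℕ × ℕ)) : Finset ℕ :=
  (Finset.range (n - 1)).filter
    (fun r => ∀ c ∈ Finset.range n, r < c → c ∉ E.image Prod.fst → (r, c) ∈ E)

theorem mem_ewZr {n : ℕ} {E : Finset (ℕ × ℕ)} {r : ℕ} : r ∈ ewZr n E ↔
    r < n - 1 ∧ ∀ c, c < n → r < c → (∀ d, (c, d) ∉ E) → (r, c) ∈ E := by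
  simp [ewZr]

theorem card_ewZr_sup (n : ℕ) (hn : 1 ≤ n) (K : Finset ℕ) (hK : K ⊆ Finset.range (n - 1)) :
    ((ewC (Finset.range n)).filter (fun E => K ⊆ ewZr n E)).card = (n - K.card).factorial := by
  classical
  have hc : (Finset.range n \ K).card = n - K.card := by
    rw [Finset.card_sdiff_of_subset, Finset.card_range]
    exact hK.trans (Finset.range_mono (by omega))
  rw [← card_ewC _ _ hc]
  have hKn : ∀ z ∈ K, z < n - 1 := fun z hz => Finset.mem_range.1 (hK hz)
  refine Finset.card_nbij' (fun E => E.filter (fun p => p.1 ∉ K))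
    (fun E' => E' ∪ (K ×ˢ (Finset.range n \ K)).filter
      (fun p => p.1 < p.2 ∧ p.2 ∉ E'.image Prod.fst)) ?_ ?_ ?_ ?_
  · intro E hE
    simp only [Finset.coe_filter, Set.mem_ofPred_eq, mem_ewC, Finset.mem_coe] at hE ⊢
    obtain ⟨⟨h1, h2, h3⟩, hZ⟩ := hE
    have hz : ∀ z ∈ K, (z, n - 1) ∈ E := by
      intro z hz
      have := mem_ewZr.1 (hZ hz)
      refine this.2 _ (by omega) this.1 fun d hd => ?_
      have := h1 _ _ hd
      simp only [Finset.mem_range] at this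
      omega
    refine ⟨?_, ?_, ?_⟩
    · intro r c h
      simp only [Finset.mem_filter] at h
      have := h1 _ _ h.1
      simp only [Finset.mem_sdiff]
      exact ⟨⟨this.1, h.2⟩, ⟨this.2.1, fun hc => h2 _ _ _ _ (hz _ hc) h.1 rfl⟩, this.2.2⟩
    · intro r c r' c' h h'
      simp only [Finset.mem_filter] at h h'
      exact h2 _ _ _ _ h.1 h'.1
    · intro r c r' c' h h' q q'
      simp only [Finset.mem_filter] at h h' ⊢
      rcases h3 _ _ _ _ h.1 h'.1 q q' with x | x
      · exact Or.inl ⟨x, h.2⟩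
      · exact Or.inr ⟨x, h'.2⟩
  · intro E hE
    simp only [Finset.coe_filter, Set.mem_ofPred_eq, mem_ewC, Finset.mem_coe] at hE ⊢
    obtain ⟨h1, h2, h3⟩ := hE
    set E2 := E ∪ (K ×ˢ (Finset.range n \ K)).filter
      (fun p => p.1 < p.2 ∧ p.2 ∉ E.image Prod.fst) with hE2
    have hm : ∀ r c, (r, c) ∈ E2 ↔ (r, c) ∈ E ∨ (r ∈ K ∧ c < n ∧ c ∉ K ∧ r < c ∧ ∀ d, (c, d) ∉ E) := by
      intro r c
      simp [hE2]
      tauto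
    clear_value E2
    have hcol : ∀ r c, (r, c) ∈ E2 → c < n ∧ c ∉ K ∧ ∀ d, (c, d) ∉ E := by
      intro r c h
      rcases (hm _ _).1 h with h | h
      · have := h1 _ _ h
        simp only [Finset.mem_sdiff, Finset.mem_range] at this
        exact ⟨this.2.1.1, this.2.1.2, fun d hd => h2 _ _ _ _ hd h rfl⟩
      · exact ⟨h.2.1, h.2.2.1, h.2.2.2.2⟩
    refine ⟨⟨?_, ?_, ?_⟩, ?_⟩
    · intro r c h
      rcases (hm _ _).1 h with h | h
      · have := h1 _ _ h
        simp only [Finset.mem_sdiff] at this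
        exact ⟨this.1.1, this.2.1.1, this.2.2⟩
      · have := hKn _ h.1
        simp only [Finset.mem_range]
        omega
    · rintro r c r' c' h h' rfl
      have := hcol _ _ h'
      rcases (hm _ _).1 h with h | h
      · exact this.2.2 _ h
      · exact this.2.1 h.1
    · intro r c r' c' h h' q q'
      have g := hcol _ _ h
      have g' := hcol _ _ h'
      rcases (hm _ _).1 h with h | h
      · rcases (hm _ _).1 h' with h' | h'
        · rcases h3 _ _ _ _ h h' q q' with x | x
          · exact Or.inl ((hm _ _).2 (Or.inl x))
          · exact Or.inr ((hm _ _).2 (Or.inl x))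
        · exact Or.inr ((hm _ _).2 (Or.inr ⟨h'.1, g.1, g.2.1, q', g.2.2⟩))
      · exact Or.inl ((hm _ _).2 (Or.inr ⟨h.1, g'.1, g'.2.1, q, g'.2.2⟩))
    · intro z hz
      have hz1 := hKn _ hz
      refine mem_ewZr.2 ⟨hz1, fun c hc hzc hno => ?_⟩
      refine (hm _ _).2 (Or.inr ⟨hz, hc, fun hcK => ?_, hzc, fun d hd => hno d ((hm _ _).2 (Or.inl hd))⟩)
      refine hno (n - 1) ((hm _ _).2 (Or.inr ⟨hcK, by omega, fun h => ?_, hKn _ hcK, fun d hd => ?_⟩))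
      · have := hKn _ h
        omega
      · have := h1 _ _ hd
        simp only [Finset.mem_sdiff, Finset.mem_range] at this
        omega
  · intro E hE
    simp only [Finset.coe_filter, Set.mem_ofPred_eq, mem_ewC] at hE
    obtain ⟨⟨h1, h2, h3⟩, hZ⟩ := hE
    have hz : ∀ z ∈ K, (z, n - 1) ∈ E := by
      intro z hz
      have := mem_ewZr.1 (hZ hz)
      refine this.2 _ (by omega) this.1 fun d hd => ?_
      have := h1 _ _ hd
      simp only [Finset.mem_range] at this
      omega
    ext ⟨r, c⟩
    simp only [Finset.mem_union, Finset.mem_filter, Finset.mem_product, Finset.mem_sdiff,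
      Finset.mem_range, Finset.mem_image, Prod.exists, not_exists, not_and]
    constructor
    · rintro (h | ⟨⟨hr, hc, hcK⟩, hrc, h⟩)
      · exact h.1
      · refine (mem_ewZr.1 (hZ hr)).2 c hc hrc fun d hd => ?_
        exact h c d ⟨hd, hcK⟩ rfl
    · intro h
      by_cases hr : r ∈ K
      · have q := h1 _ _ h
        simp only [Finset.mem_range] at q
        refine Or.inr ⟨⟨hr, q.2.1, fun hc => h2 _ _ _ _ (hz _ hc) h rfl⟩, q.2.2, ?_⟩
        rintro a d hd rfl
        exact h2 _ _ _ _ hd.1 h rfl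
      · exact Or.inl ⟨h, hr⟩
  · intro E hE
    simp only [mem_ewC, Finset.mem_coe] at hE
    obtain ⟨h1, h2, h3⟩ := hE
    ext ⟨r, c⟩
    simp only [Finset.mem_union, Finset.mem_filter, Finset.mem_product]
    constructor
    · rintro ⟨h | h, hr⟩
      · exact h
      · exact absurd h.1.1 hr
    · intro h
      have := h1 _ _ h
      simp only [Finset.mem_sdiff] at this
      exact ⟨Or.inl h, this.1.2⟩

theorem isPermOn_finite (n : ℕ) : Finite {a : ℕ → ℕ // IsPermOn n a} := by
  apply Nat.finite_of_card_ne_zero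
  have := card_perm_fix n (Finset.Icc 1 n) (Finset.Subset.refl _)
  have e : Nat.card {a : ℕ → ℕ // IsPermOn n a} =
      Nat.card {a : ℕ → ℕ // IsPermOn n a ∧ ∀ i, 1 ≤ i → i ≤ n → i ∉ Finset.Icc 1 n → a i = i} := by
    refine Nat.card_congr (Equiv.subtypeEquivRight fun a => ⟨fun h => ⟨h, ?_⟩, fun h => h.1⟩)
    intro i h1 h2 h3
    exact absurd (Finset.mem_Icc.2 ⟨h1, h2⟩) h3
  rw [e, this]
  exact Nat.factorial_ne_zero _

def ewFix (n : ℕ) (a : ℕ → ℕ) : Finset ℕ := (Finset.range (n - 1)).filter fun i => a (i + 2) = i + 2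

def ewAdj (n : ℕ) (a : ℕ → ℕ) : Finset ℕ :=
  (Finset.range (n - 1)).filter fun i => a (i + 1) = a (i + 2) + 1

theorem ncard_fix (n : ℕ) (a : ℕ → ℕ) :
    Set.ncard {i | 2 ≤ i ∧ i ≤ n ∧ a i = i} = (ewFix n a).card := by
  rw [← Set.ncard_coe_finset]
  rw [← Set.ncard_image_of_injective (ewFix n a : Set ℕ) (add_left_injective 2)]
  congr 1
  ext i
  simp only [ewFix, Set.mem_ofPred_eq, Set.mem_image, Finset.mem_coe, Finset.mem_filter,
    Finset.mem_range]
  constructor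
  · rintro ⟨h1, h2, h3⟩
    refine ⟨i - 2, ⟨by omega, ?_⟩, by omega⟩
    rw [show i - 2 + 2 = i by omega, h3]
  · rintro ⟨j, ⟨h1, h2⟩, rfl⟩
    exact ⟨by omega, by omega, h2⟩

theorem ncard_adj (n : ℕ) (a : ℕ → ℕ) :
    Set.ncard {i | 1 ≤ i ∧ i < n ∧ a i = a (i + 1) + 1} = (ewAdj n a).card := by
  rw [← Set.ncard_coe_finset]
  rw [← Set.ncard_image_of_injective (ewAdj n a : Set ℕ) (add_left_injective 1)]
  congr 1
  ext i
  simp only [ewAdj, Set.mem_ofPred_eq, Set.mem_image, Finset.mem_coe, Finset.mem_filter,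
    Finset.mem_range]
  constructor
  · rintro ⟨h1, h2, h3⟩
    refine ⟨i - 1, ⟨by omega, ?_⟩, by omega⟩
    rw [show i - 1 + 2 = i + 1 by omega, show i - 1 + 1 = i by omega, h3]
  · rintro ⟨j, ⟨h1, h2⟩, rfl⟩
    exact ⟨by omega, by omega, h2⟩

theorem card_ew_sub (n : ℕ) (hn : 1 ≤ n) (K : Finset ℕ) (hK : K ⊆ Finset.range (n - 1)) :
    Nat.card {E : {E // E ∈ ewC (Finset.range n)} // K ⊆ ewZr n E.1} = (n - K.card).factorial := by
  rw [← card_ewZr_sup n hn K hK]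
  rw [← Nat.card_eq_finsetCard]
  refine Nat.card_congr ((Equiv.subtypeSubtypeEquivSubtypeInter _ (fun E => K ⊆ ewZr n E)).trans
    (Equiv.subtypeEquivRight fun E => ?_))
  simp

theorem card_fix_sub (n : ℕ) (hn : 1 ≤ n) (K : Finset ℕ) (hK : K ⊆ Finset.range (n - 1)) :
    Nat.card {a : {a // IsPermOn n a} // K ⊆ ewFix n a.1} = (n - K.card).factorial := by
  classical
  have hsub : K.image (· + 2) ⊆ Finset.Icc 1 n := by
    intro x hx
    obtain ⟨y, hy, rfl⟩ := Finset.mem_image.1 hx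
    have := Finset.mem_range.1 (hK hy)
    simp only [Finset.mem_Icc]
    omega
  have hc : (Finset.Icc 1 n \ K.image (· + 2)).card = n - K.card := by
    rw [Finset.card_sdiff_of_subset hsub, Finset.card_image_of_injective _ (add_left_injective 2)]
    simp
  rw [← hc, ← card_perm_fix n _ Finset.sdiff_subset]
  refine Nat.card_congr ((Equiv.subtypeSubtypeEquivSubtypeInter _ (fun a => K ⊆ ewFix n a)).trans
    (Equiv.subtypeEquivRight fun a => and_congr_right fun _ => ?_))
  constructor
  · intro h i h1 h2 h3
    simp only [Finset.mem_sdiff, Finset.mem_Icc, not_and, not_not, Finset.mem_image] at h3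
    obtain ⟨y, hy, rfl⟩ := h3 ⟨h1, h2⟩
    exact (Finset.mem_filter.1 (h hy)).2
  · intro h y hy
    have := Finset.mem_range.1 (hK hy)
    refine Finset.mem_filter.2 ⟨hK hy, h _ (by omega) (by omega) ?_⟩
    intro h'
    exact (Finset.mem_sdiff.1 h').2 (Finset.mem_image_of_mem _ hy)

theorem card_adj_sub (n : ℕ) (hn : 1 ≤ n) (K : Finset ℕ) (hK : K ⊆ Finset.range (n - 1)) :
    Nat.card {a : {a // IsPermOn n a} // K ⊆ ewAdj n a.1} = (n - K.card).factorial := by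
  rw [← card_adj K n hn hK]
  refine Nat.card_congr ((Equiv.subtypeSubtypeEquivSubtypeInter _ (fun a => K ⊆ ewAdj n a)).trans
    (Equiv.subtypeEquivRight fun a => and_congr_right fun _ => ?_))
  constructor
  · intro h i hi
    exact (Finset.mem_filter.1 (h hi)).2
  · intro h y hy
    exact Finset.mem_filter.2 ⟨hK hy, h _ hy⟩

theorem ew_final (n k : ℕ) (hn : 1 ≤ n) :
    Nat.card {E : {E // E ∈ ewC (Finset.range n)} // (ewZr n E.1).card = k}
      = Nat.card {a : ℕ → ℕ // IsPermOn n a ∧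
          Set.ncard {i | 2 ≤ i ∧ i ≤ n ∧ a i = i} = k} ∧
    Nat.card {E : {E // E ∈ ewC (Finset.range n)} // (ewZr n E.1).card = k}
      = Nat.card {a : ℕ → ℕ // IsPermOn n a ∧
          Set.ncard {i | 1 ≤ i ∧ i < n ∧ a i = a (i + 1) + 1} = k} := by
  have := isPermOn_finite n
  constructor
  · rw [incl_excl (Finset.range (n - 1)) (fun E : {E // E ∈ ewC (Finset.range n)} => ewZr n E.1)
      (fun a : {a // IsPermOn n a} => ewFix n a.1) (fun _ => Finset.filter_subset _ _)
      (fun _ => Finset.filter_subset _ _)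
      (fun K hK => (card_ew_sub n hn K hK).trans (card_fix_sub n hn K hK).symm) k]
    refine Nat.card_congr ((Equiv.subtypeSubtypeEquivSubtypeInter _
      (fun a => (ewFix n a).card = k)).trans
      (Equiv.subtypeEquivRight fun a => and_congr_right fun _ => ?_))
    rw [ncard_fix]
  · rw [incl_excl (Finset.range (n - 1)) (fun E : {E // E ∈ ewC (Finset.range n)} => ewZr n E.1)
      (fun a : {a // IsPermOn n a} => ewAdj n a.1) (fun _ => Finset.filter_subset _ _)
      (fun _ => Finset.filter_subset _ _)
      (fun K hK => (card_ew_sub n hn K hK).trans (card_adj_sub n hn K hK).symm) k]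
    refine Nat.card_congr ((Equiv.subtypeSubtypeEquivSubtypeInter _
      (fun a => (ewAdj n a).card = k)).trans
      (Equiv.subtypeEquivRight fun a => and_congr_right fun _ => ?_))
    rw [ncard_adj]

def rowL (F : FerrersShape) (i : ℕ) : ℕ := (i - 1) + (F.len 0 - F.len i)

def colL (F : FerrersShape) (j : ℕ) : ℕ :=
  (F.len 0 - 1 - j) + ((Finset.Ico 1 F.r).filter fun i => j < F.len i).card

theorem len_le (F : FerrersShape) (i : ℕ) : F.len i ≤ F.len 0 := by
  by_cases h : i < F.r
  · exact F.anti 0 i (Nat.zero_le _) h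
  · rw [F.len_zero i (by omega)]
    exact Nat.zero_le _

theorem rowL_lt (F : FerrersShape) {i i' : ℕ} (h1 : 1 ≤ i) (h : i < i') (h' : i' < F.r) :
    rowL F i < rowL F i' := by
  have := F.anti i i' h.le h'
  unfold rowL
  omega

theorem colL_lt (F : FerrersShape) {j j' : ℕ} (h : j < j') (h' : j' < F.len 0) :
    colL F j' < colL F j := by
  have : ((Finset.Ico 1 F.r).filter fun i => j' < F.len i).card ≤
      ((Finset.Ico 1 F.r).filter fun i => j < F.len i).card :=
    Finset.card_le_card (Finset.monotone_filter_right _ fun i _ hi => lt_trans h hi)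
  unfold colL
  omega

theorem rowL_lt_colL (F : FerrersShape) {i j : ℕ} (h1 : 1 ≤ i) (hi : i < F.r)
    (hj : j < F.len i) : rowL F i < colL F j := by
  have h2 : (Finset.Icc 1 i).card ≤ ((Finset.Ico 1 F.r).filter fun i => j < F.len i).card := by
    apply Finset.card_le_card
    intro x hx
    rw [Finset.mem_Icc] at hx
    rw [Finset.mem_filter, Finset.mem_Ico]
    exact ⟨⟨hx.1, by omega⟩, lt_of_lt_of_le hj (F.anti x i hx.2 hi)⟩
  rw [Nat.card_Icc] at h2
  have := len_le F i
  unfold rowL colL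
  omega

theorem colL_lt_rowL (F : FerrersShape) {i j : ℕ} (h1 : 1 ≤ i) (hi : i < F.r)
    (hj : F.len i ≤ j) (hj' : j < F.len 0) : colL F j < rowL F i := by
  have h2 : ((Finset.Ico 1 F.r).filter fun i => j < F.len i).card ≤ (Finset.Ico 1 i).card := by
    apply Finset.card_le_card
    intro x hx
    rw [Finset.mem_filter, Finset.mem_Ico] at hx
    rw [Finset.mem_Ico]
    refine ⟨hx.1.1, ?_⟩
    by_contra hc
    have := F.anti i x (by omega) hx.1.2
    omega
  rw [Nat.card_Ico] at h2
  have := len_le F i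
  unfold rowL colL
  omega

theorem rowL_ne_colL (F : FerrersShape) {i j : ℕ} (h1 : 1 ≤ i) (hi : i < F.r)
    (hj' : j < F.len 0) : rowL F i ≠ colL F j := by
  rcases lt_or_ge j (F.len i) with h | h
  · exact (rowL_lt_colL F h1 hi h).ne
  · exact (colL_lt_rowL F h1 hi h hj').ne'

theorem lt_len_of (F : FerrersShape) {i j : ℕ} (h1 : 1 ≤ i) (hi : i < F.r)
    (hj' : j < F.len 0) (h : rowL F i < colL F j) : j < F.len i := by
  by_contra hc
  have := colL_lt_rowL F h1 hi (not_lt.1 hc) hj'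
  omega

theorem rowL_inj (F : FerrersShape) {i i' : ℕ} (h1 : 1 ≤ i) (hi : i < F.r) (h1' : 1 ≤ i')
    (hi' : i' < F.r) (h : rowL F i = rowL F i') : i = i' := by
  rcases lt_trichotomy i i' with h2 | h2 | h2
  · have := rowL_lt F h1 h2 hi'
    omega
  · exact h2
  · have := rowL_lt F h1' h2 hi
    omega

theorem colL_inj (F : FerrersShape) {i i' : ℕ} (hi : i < F.len 0)
    (hi' : i' < F.len 0) (h : colL F i = colL F i') : i = i' := by
  rcases lt_trichotomy i i' with h2 | h2 | h2
  · have := colL_lt F h2 hi'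
    omega
  · exact h2
  · have := colL_lt F h2 hi
    omega

theorem rowL_bd (F : FerrersShape) {n i : ℕ} (hn : F.r + F.len 0 = n + 1) (h1 : 1 ≤ i)
    (hi : i < F.r) : rowL F i < n - 1 := by
  have := F.len_pos i hi
  have := len_le F i
  unfold rowL
  omega

theorem colL_bd (F : FerrersShape) {n j : ℕ} (hn : F.r + F.len 0 = n + 1)
    (hj : j < F.len 0) : colL F j < n := by
  have h := Finset.card_filter_le (Finset.Ico 1 F.r) fun i => j < F.len i
  rw [Nat.card_Ico] at h
  have := F.r_pos
  unfold colL
  omega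

theorem lab_cover (F : FerrersShape) {n x : ℕ} (hn : F.r + F.len 0 = n + 1) (hx : x < n) :
    (∃ i, 1 ≤ i ∧ i < F.r ∧ rowL F i = x) ∨ ∃ j, j < F.len 0 ∧ colL F j = x := by
  classical
  have hr := F.r_pos
  have e : (Finset.Ico 1 F.r).image (rowL F) ∪ (Finset.range (F.len 0)).image (colL F)
      = Finset.range n := by
    apply Finset.eq_of_subset_of_card_le
    · intro y hy
      rw [Finset.mem_range]
      rcases Finset.mem_union.1 hy with hy | hy
      · obtain ⟨i, hi, rfl⟩ := Finset.mem_image.1 hy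
        rw [Finset.mem_Ico] at hi
        have := rowL_bd F hn hi.1 hi.2
        omega
      · obtain ⟨i, hi, rfl⟩ := Finset.mem_image.1 hy
        exact colL_bd F hn (Finset.mem_range.1 hi)
    · rw [Finset.card_union_of_disjoint, Finset.card_image_of_injOn, Finset.card_image_of_injOn]
      · simp only [Finset.card_range, Nat.card_Ico]
        omega
      · intro a ha b hb h
        simp only [Finset.mem_coe, Finset.mem_range] at ha hb
        exact colL_inj F ha hb h
      · intro a ha b hb h
        simp only [Finset.mem_coe, Finset.mem_Ico] at ha hb
        exact rowL_inj F ha.1 ha.2 hb.1 hb.2 h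
      · rw [Finset.disjoint_left]
        intro y hy hy'
        obtain ⟨i, hi, rfl⟩ := Finset.mem_image.1 hy
        obtain ⟨j, hj, h⟩ := Finset.mem_image.1 hy'
        rw [Finset.mem_Ico] at hi
        exact rowL_ne_colL F hi.1 hi.2 (Finset.mem_range.1 hj) h.symm
  have := e ▸ Finset.mem_range.2 hx
  rcases Finset.mem_union.1 this with hy | hy
  · obtain ⟨i, hi, h⟩ := Finset.mem_image.1 hy
    rw [Finset.mem_Ico] at hi
    exact Or.inl ⟨i, hi.1, hi.2, h⟩
  · obtain ⟨i, hi, h⟩ := Finset.mem_image.1 hy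
    exact Or.inr ⟨i, Finset.mem_range.1 hi, h⟩

def encT (T : Σ F : FerrersShape, EWTableau F) : Finset (ℕ × ℕ) :=
  ((Finset.Ico 1 T.1.r ×ˢ Finset.range (T.1.len 0)).filter
    (fun p => p.2 < T.1.len p.1 ∧ T.2.one p.1 p.2 = false)).image
    (fun p => (rowL T.1 p.1, colL T.1 p.2))

theorem mem_encT (T : Σ F : FerrersShape, EWTableau F) (x y : ℕ) : (x, y) ∈ encT T ↔
    ∃ i j, 1 ≤ i ∧ i < T.1.r ∧ j < T.1.len i ∧ T.2.one i j = false ∧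
      rowL T.1 i = x ∧ colL T.1 j = y := by
  unfold encT
  simp only [Finset.mem_image, Finset.mem_filter, Finset.mem_product, Finset.mem_Ico,
    Finset.mem_range, Prod.exists, Prod.mk.injEq]
  constructor
  · rintro ⟨i, j, ⟨⟨⟨h1, h2⟩, h3⟩, h4, h5⟩, h6, h7⟩
    exact ⟨i, j, h1, h2, h4, h5, h6, h7⟩
  · rintro ⟨i, j, h1, h2, h4, h5, h6, h7⟩
    exact ⟨i, j, ⟨⟨⟨h1, h2⟩, lt_of_lt_of_le h4 (len_le _ _)⟩, h4, h5⟩, h6, h7⟩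

theorem mem_encT' (T : Σ F : FerrersShape, EWTableau F) {i j : ℕ} (h1 : 1 ≤ i) (hi : i < T.1.r)
    (hj : j < T.1.len i) : (rowL T.1 i, colL T.1 j) ∈ encT T ↔ T.2.one i j = false := by
  rw [mem_encT]
  constructor
  · rintro ⟨i', j', a1, a2, a3, a4, a5, a6⟩
    obtain rfl := rowL_inj T.1 a1 a2 h1 hi a5
    obtain rfl := colL_inj T.1 (lt_of_lt_of_le a3 (len_le _ _)) (lt_of_lt_of_le hj (len_le _ _)) a6
    exact a4
  · intro h
    exact ⟨i, j, h1, hi, hj, h, rfl, rfl⟩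

theorem fst_encT (T : Σ F : FerrersShape, EWTableau F) (x : ℕ) : (∃ y, (x, y) ∈ encT T) ↔
    ∃ i, 1 ≤ i ∧ i < T.1.r ∧ rowL T.1 i = x := by
  constructor
  · rintro ⟨y, h⟩
    obtain ⟨i, j, h1, h2, h4, h5, h6, h7⟩ := (mem_encT _ _ _).1 h
    exact ⟨i, h1, h2, h6⟩
  · rintro ⟨i, h1, h2, h3⟩
    obtain ⟨j, hj, h⟩ := T.2.has_zero i h1 h2
    exact ⟨colL T.1 j, (mem_encT _ _ _).2 ⟨i, j, h1, h2, hj, h, h3, rfl⟩⟩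

theorem encT_ok (T : Σ F : FerrersShape, EWTableau F) (n : ℕ) (hn : T.1.r + T.1.len 0 = n + 1) :
    EwOk (Finset.range n) (encT T) := by
  refine ⟨?_, ?_, ?_⟩
  · intro x y h
    obtain ⟨i, j, h1, h2, h4, h5, rfl, rfl⟩ := (mem_encT _ _ _).1 h
    have a := rowL_bd T.1 hn h1 h2
    have b := colL_bd T.1 hn (lt_of_lt_of_le h4 (len_le _ _))
    have c := rowL_lt_colL T.1 h1 h2 h4
    simp only [Finset.mem_range]
    omega
  · intro x y x' y' h h'
    obtain ⟨i, j, h1, h2, h4, h5, rfl, rfl⟩ := (mem_encT _ _ _).1 h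
    obtain ⟨i', j', h1', h2', h4', h5', rfl, rfl⟩ := (mem_encT _ _ _).1 h'
    exact rowL_ne_colL T.1 h1 h2 (lt_of_lt_of_le h4' (len_le _ _))
  · intro x y x' y' h h' q q'
    obtain ⟨i, j, h1, h2, h4, h5, rfl, rfl⟩ := (mem_encT _ _ _).1 h
    obtain ⟨i', j', h1', h2', h4', h5', rfl, rfl⟩ := (mem_encT _ _ _).1 h'
    have g := lt_len_of T.1 h1 h2 (lt_of_lt_of_le h4' (len_le _ _)) q
    have g' := lt_len_of T.1 h1' h2' (lt_of_lt_of_le h4 (len_le _ _)) q'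
    rw [mem_encT' T h1 h2 g, mem_encT' T h1' h2' g']
    by_contra! hc
    obtain ⟨c1, c2⟩ := hc
    rw [Bool.ne_false_iff] at c1 c2
    rcases lt_trichotomy i i' with hi | rfl | hi
    · rcases lt_trichotomy j j' with hj | rfl | hj
      · exact T.2.no_rect i i' j j' hi h2' hj h4' (by simp [*])
      · simp_all
      · exact T.2.no_rect i i' j' j hi h2' hj g' (by simp [*])
    · simp_all
    · rcases lt_trichotomy j j' with hj | rfl | hj
      · exact T.2.no_rect i' i j j' hi h2 hj g (by simp [*])
      · simp_all
      · exact T.2.no_rect i' i j' j hi h2 hj h4 (by simp [*])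

theorem encT_zr (T : Σ F : FerrersShape, EWTableau F) (n : ℕ) (hn : T.1.r + T.1.len 0 = n + 1) :
    (ewZr n (encT T)).card
      = Set.ncard {i | i < T.1.r ∧ ∀ j, j < T.1.len i → T.2.one i j = false} := by
  have hr := T.1.r_pos
  have hc := T.1.len_pos 0 hr
  rw [← Set.ncard_coe_finset]
  have hpos : ∀ i ∈ {i | i < T.1.r ∧ ∀ j, j < T.1.len i → T.2.one i j = false},
      1 ≤ i ∧ i < T.1.r := by
    rintro i ⟨h1, h2⟩
    refine ⟨?_, h1⟩
    by_contra h
    obtain rfl : i = 0 := by omega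
    have := h2 0 hc
    rw [T.2.top_row 0 hc] at this
    exact absurd this (by simp)
  rw [← Set.ncard_image_of_injOn (f := rowL T.1)
    (s := {i | i < T.1.r ∧ ∀ j, j < T.1.len i → T.2.one i j = false})]
  · congr 1
    ext x
    simp only [Finset.mem_coe, mem_ewZr, Set.mem_image]
    constructor
    · rintro ⟨h1, h2⟩
      have h3 : (x, n - 1) ∈ encT T := by
        refine h2 (n - 1) (by omega) h1 fun d hd => ?_
        have := (encT_ok T n hn).1 _ _ hd
        simp only [Finset.mem_range] at this
        omega
      obtain ⟨i, i1, i2, rfl⟩ := (fst_encT T x).1 ⟨_, h3⟩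
      refine ⟨i, ⟨i2, fun j hj => ?_⟩, rfl⟩
      rw [← mem_encT' T i1 i2 hj]
      have hj0 : j < T.1.len 0 := lt_of_lt_of_le hj (len_le _ _)
      refine h2 _ (colL_bd T.1 hn hj0) (rowL_lt_colL T.1 i1 i2 hj) fun d hd => ?_
      obtain ⟨i', a1, a2, a3⟩ := (fst_encT T _).1 ⟨_, hd⟩
      exact rowL_ne_colL T.1 a1 a2 hj0 a3
    · rintro ⟨i, hi, rfl⟩
      obtain ⟨i1, i2⟩ := hpos i hi
      refine ⟨rowL_bd T.1 hn i1 i2, fun c hc hic hno => ?_⟩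
      rcases lab_cover T.1 hn hc with ⟨i', a1, a2, rfl⟩ | ⟨j, hj, rfl⟩
      · obtain ⟨y, hy⟩ := (fst_encT T _).2 ⟨i', a1, a2, rfl⟩
        exact absurd hy (hno y)
      · have hj' := lt_len_of T.1 i1 i2 hj hic
        rw [mem_encT' T i1 i2 hj']
        exact hi.2 j hj'
  · intro a ha b hb h
    have := hpos a ha
    have h' := hpos b hb
    exact rowL_inj T.1 this.1 this.2 h'.1 h'.2 h

theorem enum_unique (m : ℕ) (f g : ℕ → ℕ) (hf : ∀ i j, 1 ≤ i → i < j → j < m → f i < f j)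
    (hg : ∀ i j, 1 ≤ i → i < j → j < m → g i < g j)
    (h : ∀ x, (∃ i, 1 ≤ i ∧ i < m ∧ f i = x) ↔ ∃ i, 1 ≤ i ∧ i < m ∧ g i = x) :
    ∀ i, 1 ≤ i → i < m → f i = g i := by
  intro i
  induction i using Nat.strong_induction_on with
  | _ i ih =>
    intro h1 h2
    obtain ⟨j, j1, j2, j3⟩ := (h (f i)).1 ⟨i, h1, h2, rfl⟩
    obtain ⟨l, l1, l2, l3⟩ := (h (g i)).2 ⟨i, h1, h2, rfl⟩
    rcases lt_trichotomy j i with hj | rfl | hj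
    · have := ih j hj j1 j2
      have := hf j i j1 hj h2
      omega
    · exact j3.symm
    · have := hg i j h1 hj j2
      rcases lt_trichotomy l i with hl | rfl | hl
      · have := ih l hl l1 l2
        have := hg l i l1 hl h2
        omega
      · exact l3
      · have := hf i l h1 hl l2
        omega

theorem shape_unique (F G : FerrersShape) (n : ℕ) (hF : F.r + F.len 0 = n + 1)
    (hG : G.r + G.len 0 = n + 1)
    (h : ∀ x, (∃ i, 1 ≤ i ∧ i < F.r ∧ rowL F i = x) ↔ ∃ i, 1 ≤ i ∧ i < G.r ∧ rowL G i = x) :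
    F = G := by
  have hr : F.r = G.r := by
    have a : ∀ H : FerrersShape, ((Finset.Ico 1 H.r).image (rowL H)).card = H.r - 1 := by
      intro H
      rw [Finset.card_image_of_injOn, Nat.card_Ico]
      intro a ha b hb h
      simp only [Finset.mem_coe, Finset.mem_Ico] at ha hb
      exact rowL_inj H ha.1 ha.2 hb.1 hb.2 h
    have e : (Finset.Ico 1 F.r).image (rowL F) = (Finset.Ico 1 G.r).image (rowL G) := by
      ext x
      simpa only [Finset.mem_image, Finset.mem_Ico, and_assoc] using h x
    have := a F
    rw [e, a G] at this
    have := F.r_pos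
    have := G.r_pos
    omega
  have hu := enum_unique F.r (rowL F) (rowL G) (fun i j a b c => rowL_lt F a b c)
    (fun i j a b c => rowL_lt G a b (hr ▸ c)) (by
      intro x
      rw [h x, hr])
  have hl : F.len = G.len := by
    funext i
    by_cases hi : i < F.r
    · by_cases h0 : i = 0
      · subst h0
        omega
      · have := hu i (by omega) hi
        have a := len_le F i
        have b := len_le G i
        unfold rowL at this
        omega
    · rw [F.len_zero i (by omega), G.len_zero i (by omega)]
  cases F
  cases G
  simp only at hr hl
  subst hr hl
  rfl

theorem encT_inj (n : ℕ) (T T' : Σ F : FerrersShape, EWTableau F)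
    (hT : T.1.r + T.1.len 0 = n + 1) (hT' : T'.1.r + T'.1.len 0 = n + 1)
    (h : encT T = encT T') : T = T' := by
  have hF : T.1 = T'.1 := by
    refine shape_unique _ _ n hT hT' fun x => ?_
    rw [← fst_encT, ← fst_encT, h]
  obtain ⟨F, A⟩ := T
  obtain ⟨G, B⟩ := T'
  simp only at hF
  subst hF
  have ho : A.one = B.one := by
    funext i j
    by_cases hij : i < F.r ∧ j < F.len i
    · by_cases h0 : i = 0
      · subst h0
        rw [A.top_row j hij.2, B.top_row j hij.2]
      · have a := mem_encT' ⟨F, A⟩ (by omega : 1 ≤ i) hij.1 hij.2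
        have b := mem_encT' ⟨F, B⟩ (by omega : 1 ≤ i) hij.1 hij.2
        rw [h] at a
        have c := a.symm.trans b
        simp only at c
        cases hA : A.one i j <;> cases hB : B.one i j <;> simp_all
    · have a : A.one i j = false := by
        by_contra hc
        exact hij (A.support i j (by simpa using hc))
      have b : B.one i j = false := by
        by_contra hc
        exact hij (B.support i j (by simpa using hc))
      rw [a, b]
  cases A
  cases B
  simp only at ho
  subst ho
  rfl

theorem exists_enum (R : Finset ℕ) : ∃ f : ℕ → ℕ,
    (∀ i j, 1 ≤ i → i < j → j < R.card + 1 → f i < f j) ∧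
    ∀ x, x ∈ R ↔ ∃ i, 1 ≤ i ∧ i < R.card + 1 ∧ f i = x := by
  refine ⟨fun i => if h : i - 1 < R.card then R.orderEmbOfFin rfl ⟨i - 1, h⟩ else 0, ?_, ?_⟩
  · intro i j h1 h2 h3
    have a : i - 1 < R.card := by omega
    have b : j - 1 < R.card := by omega
    simp only [a, b, dif_pos]
    apply (R.orderEmbOfFin rfl).strictMono
    simp only [Fin.mk_lt_mk]
    omega
  · intro x
    rw [← Finset.mem_coe, ← Finset.range_orderEmbOfFin R rfl]
    constructor
    · rintro ⟨y, rfl⟩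
      refine ⟨y + 1, by omega, by omega, ?_⟩
      simp
    · rintro ⟨i, h1, h2, rfl⟩
      have a : i - 1 < R.card := by omega
      simp only [a, dif_pos]
      exact ⟨_, rfl⟩

theorem shape_exists (n : ℕ) (hn : 1 ≤ n) (R : Finset ℕ) (hR : R ⊆ Finset.range (n - 1)) :
    ∃ F : FerrersShape, F.r + F.len 0 = n + 1 ∧
      ∀ x, x ∈ R ↔ ∃ i, 1 ≤ i ∧ i < F.r ∧ rowL F i = x := by
  obtain ⟨f, hf, hfR⟩ := exists_enum R
  have hcard : R.card ≤ n - 1 := by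
    have := Finset.card_le_card hR
    simpa using this
  have hb : ∀ i, 1 ≤ i → i < R.card + 1 → f i < n - 1 := by
    intro i h1 h2
    exact Finset.mem_range.1 (hR ((hfR _).2 ⟨i, h1, h2, rfl⟩))
  have hstep : ∀ d i, 1 ≤ i → i + d < R.card + 1 → f i + d ≤ f (i + d) := by
    intro d
    induction d with
    | zero => intro i _ _; simp
    | succ d ih =>
      intro i h1 h2
      have := ih i h1 (by omega)
      have := hf (i + d) (i + (d + 1)) (by omega) (by omega) h2
      omega
  have hlow : ∀ i, 1 ≤ i → i < R.card + 1 → i - 1 ≤ f i := by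
    intro i h1 h2
    have := hstep (i - 1) 1 le_rfl (by omega)
    rw [show 1 + (i - 1) = i by omega] at this
    omega
  have hup : ∀ i, 1 ≤ i → i < R.card + 1 → f i - (i - 1) < n - R.card := by
    intro i h1 h2
    have := hstep (R.card - i) i h1 (by omega)
    rw [show i + (R.card - i) = R.card by omega] at this
    have := hb R.card (by omega) (by omega)
    omega
  let F : FerrersShape :=
    { r := R.card + 1
      len := fun i => if i = 0 then n - R.card else
        if i < R.card + 1 then n - R.card - (f i - (i - 1)) else 0
      r_pos := by omega
      anti := by
        intro i j hij hj
        by_cases h0 : i = 0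
        · subst h0
          simp only [if_true]
          split_ifs <;> omega
        · have h0' : j ≠ 0 := by omega
          have hi : i < R.card + 1 := by omega
          simp only [h0, h0', hj, hi, if_true, if_false]
          have := hstep (j - i) i (by omega) (by omega)
          rw [show i + (j - i) = j by omega] at this
          omega
      len_pos := by
        intro i hi
        by_cases h0 : i = 0
        · subst h0
          simp only [if_true]
          omega
        · simp only [h0, hi, if_true, if_false]
          have := hup i (by omega) hi
          omega
      len_zero := by
        intro i hi
        rw [if_neg (by omega), if_neg (by omega)] }
  have hrow : ∀ i, 1 ≤ i → i < R.card + 1 → rowL F i = f i := by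
    intro i h1 h2
    have a := hlow i h1 h2
    have b := hup i h1 h2
    have c : i ≠ 0 := by omega
    simp only [rowL, F, c, h2, if_true, if_false]
    omega
  refine ⟨F, ?_, ?_⟩
  · simp only [F, if_true]
    omega
  · intro x
    rw [hfR x]
    constructor
    · rintro ⟨i, h1, h2, h3⟩
      exact ⟨i, h1, h2, (hrow i h1 h2).trans h3⟩
    · rintro ⟨i, h1, h2, h3⟩
      exact ⟨i, h1, h2, (hrow i h1 h2).symm.trans h3⟩

theorem encT_surj (n : ℕ) (hn : 1 ≤ n) (E : Finset (ℕ × ℕ)) (hE : EwOk (Finset.range n) E) :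
    ∃ T : Σ F : FerrersShape, EWTableau F, T.1.r + T.1.len 0 = n + 1 ∧ encT T = E := by
  classical
  obtain ⟨h1, h2, h3⟩ := hE
  obtain ⟨F, hF, hR⟩ := shape_exists n hn (E.image Prod.fst) (by
    intro x hx
    obtain ⟨⟨a, b⟩, hp, rfl⟩ := Finset.mem_image.1 hx
    have := h1 _ _ hp
    simp only [Finset.mem_range] at this ⊢
    omega)
  have hdec : ∀ x y, (x, y) ∈ E → ∃ i j, 1 ≤ i ∧ i < F.r ∧ j < F.len i ∧
      rowL F i = x ∧ colL F j = y := by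
    intro x y hxy
    obtain ⟨i, i1, i2, rfl⟩ := (hR x).1 (Finset.mem_image.2 ⟨(x, y), hxy, rfl⟩)
    have hb := h1 _ _ hxy
    simp only [Finset.mem_range] at hb
    rcases lab_cover F hF hb.2.1 with hy | ⟨j, hj, rfl⟩
    · exfalso
      obtain ⟨⟨a, b⟩, hab, rfl⟩ := Finset.mem_image.1 ((hR y).2 hy)
      exact h2 _ _ _ _ hab hxy rfl
    · exact ⟨i, j, i1, i2, lt_len_of F i1 i2 hj hb.2.2, rfl, rfl⟩
  let A : EWTableau F :=
    { one := fun i j => decide (i < F.r ∧ j < F.len i ∧ (i = 0 ∨ (rowL F i, colL F j) ∉ E))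
      support := by
        intro i j h
        rw [decide_eq_true_eq] at h
        exact ⟨h.1, h.2.1⟩
      top_row := by
        intro j hj
        rw [decide_eq_true_eq]
        exact ⟨F.r_pos, hj, Or.inl rfl⟩
      has_zero := by
        intro i h0 hi
        obtain ⟨⟨a, b⟩, hab, ha⟩ := Finset.mem_image.1 ((hR (rowL F i)).2 ⟨i, h0, hi, rfl⟩)
        simp only at ha
        subst ha
        obtain ⟨i', j, a1, a2, a3, a4, rfl⟩ := hdec _ _ hab
        obtain rfl := rowL_inj F a1 a2 h0 hi a4
        refine ⟨j, a3, ?_⟩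
        rw [decide_eq_false_iff_not]
        rintro ⟨-, -, h | h⟩
        · omega
        · exact h hab
      no_rect := by
        rintro i i' j j' hi hi' hj hj' ⟨e1, e2, e3⟩
        have l1 : j' < F.len i := lt_of_lt_of_le hj' (F.anti i i' hi.le hi')
        have l2 : j < F.len i := hj.trans l1
        have l3 : j < F.len i' := hj.trans hj'
        have r1 : i < F.r := hi.trans hi'
        have z' : i' ≠ 0 := by omega
        by_cases z : i = 0
        · subst z
          apply e3
          simp [r1, l1, l2]
        · have i1 : 1 ≤ i := by omega
          have i1' : 1 ≤ i' := by omega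
          simp only [r1, hi', l1, l2, l3, hj', z, z', true_and, false_or, decide_eq_decide, ne_eq,
            not_iff_not] at e1 e2 e3
          by_cases m : (rowL F i, colL F j) ∈ E
          · have m' := e1.1 m
            rcases h3 _ _ _ _ m m' (rowL_lt_colL F i1 r1 l1) (rowL_lt_colL F i1' hi' l3) with q | q
            · tauto
            · tauto
          · have m1 : (rowL F i, colL F j') ∈ E := by tauto
            have m2 := e2.1 m1
            rcases h3 _ _ _ _ m1 m2 (rowL_lt_colL F i1 r1 l2) (rowL_lt_colL F i1' hi' hj') with q | q
            · tauto
            · tauto }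
  refine ⟨⟨F, A⟩, hF, ?_⟩
  have hA : ∀ i j, 1 ≤ i → i < F.r → j < F.len i →
      (A.one i j = false ↔ (rowL F i, colL F j) ∈ E) := by
    intro i j i1 i2 hj
    have z : i ≠ 0 := by omega
    simp [A, i2, hj, z]
  ext ⟨x, y⟩
  rw [mem_encT]
  constructor
  · rintro ⟨i, j, a1, a2, a3, a4, rfl, rfl⟩
    exact (hA i j a1 a2 a3).1 a4
  · intro hxy
    obtain ⟨i, j, a1, a2, a3, rfl, rfl⟩ := hdec _ _ hxy
    exact ⟨i, j, a1, a2, a3, (hA i j a1 a2 a3).2 hxy, rfl, rfl⟩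

theorem tableau_card (n k : ℕ) (hn : 1 ≤ n) :
    Nat.card {T : Σ F : FerrersShape, EWTableau F //
        T.1.r + T.1.len 0 = n + 1 ∧
        Set.ncard {i | i < T.1.r ∧ ∀ j, j < T.1.len i → T.2.one i j = false} = k}
    = Nat.card {E : {E // E ∈ ewC (Finset.range n)} // (ewZr n E.1).card = k} := by
  refine Nat.card_eq_of_bijective
    (fun T => ⟨⟨encT T.1, mem_ewC.2 (encT_ok T.1 n T.2.1)⟩, (encT_zr T.1 n T.2.1).trans T.2.2⟩)
    ⟨?_, ?_⟩
  · intro T T' h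
    apply Subtype.ext
    refine encT_inj n _ _ T.2.1 T'.2.1 ?_
    exact congrArg (fun x => x.1.1) h
  · rintro ⟨⟨E, hE⟩, hk⟩
    obtain ⟨T, hT, rfl⟩ := encT_surj n hn E (mem_ewC.1 hE)
    exact ⟨⟨T, hT, (encT_zr T n hT).symm.trans hk⟩, rfl⟩

/-- for every `n ≥ 1` and `k ≥ 0`, the number of EW-tableaux of
size `n` with exactly `k` all-zero rows equals the number of `n`-permutations
with exactly `k` fixed points different from 1, and also equals the number of
`n`-permutations with exactly `k` decreasing adjacencies. -/
theorem ewTableaux_allZeroRows_distribution (n k : ℕ) (hn : 0 < n) :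
    (Nat.card {T : Σ F : FerrersShape, EWTableau F //
        T.1.r + T.1.len 0 = n + 1 ∧
        Set.ncard {i | i < T.1.r ∧ ∀ j, j < T.1.len i → T.2.one i j = false} = k}
      = Nat.card {a : ℕ → ℕ // IsPermOn n a ∧
          Set.ncard {i | 2 ≤ i ∧ i ≤ n ∧ a i = i} = k}) ∧
    (Nat.card {T : Σ F : FerrersShape, EWTableau F //
        T.1.r + T.1.len 0 = n + 1 ∧
        Set.ncard {i | i < T.1.r ∧ ∀ j, j < T.1.len i → T.2.one i j = false} = k}
      = Nat.card {a : ℕ → ℕ // IsPermOn n a ∧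
          Set.ncard {i | 1 ≤ i ∧ i < n ∧ a i = a (i + 1) + 1} = k}) := by
  rw [tableau_card n k hn]
  exact ew_final n k hn
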